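/- There exist universal constants c₀ > 0 and C > 0 (independent of q, n, r and the design) with the following property. Let {Π_{ik}} be a complete measurement design on ℂ^q with Gram superoperator G, and suppose r ≥ c₀ q · tr((nG)^{-1}), where tr((nG)^{-1}) is the trace of the inverse of nG as a real-linear endomorphism of the Hermitian q×q matrices. Then for every estimator, i.e. every function ρ̂ from the finite sample space Π_{i=1}^n {1,…,q_i}^r to ℂ^{q×q}, one has sup over density matrices ρ of E_ρ[‖ρ̂((Y_{ij})) − ρ‖₂²] ≥ C q²/(n r), where E_ρ is the expectation under the product distribution in which the Y_{ij} (1 ≤ i ≤ n, 1 ≤ j ≤ r) are independent with P(Y_{ij} = k) = tr(ρ Π_{ik}). -/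

import Mathlib

open Matrix Finset
open scoped ComplexOrder

noncomputable section

/-- The Gram superoperator `G[S] = (1/n) Σ_i Σ_k (tr(S Π_{ik})/m_{ik}) Π_{ik}`. -/
def gramOf {q n : ℕ} (out : Fin n → ℕ)
    (P : (i : Fin n) → Fin (out i) → Matrix (Fin q) (Fin q) ℂ)
    (S : Matrix (Fin q) (Fin q) ℂ) : Matrix (Fin q) (Fin q) ℂ :=
  (n : ℂ)⁻¹ • ∑ i, ∑ k, ((S * P i k).trace / (P i k).trace) • P i k

/-- The squared Frobenius (Hilbert–Schmidt) norm of a complex matrix. -/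
def frobSq {q : ℕ} (M : Matrix (Fin q) (Fin q) ℂ) : ℝ :=
  ∑ a, ∑ b, Complex.normSq (M a b)

theorem one_sub_sum_le_prod {ι : Type*} (s : Finset ι) (x : ι → ℝ) (h0 : ∀ i ∈ s, 0 ≤ x i)
    (h1 : ∀ i ∈ s, x i ≤ 1) : 1 - ∑ i ∈ s, (1 - x i) ≤ ∏ i ∈ s, x i := by
  classical
  induction s using Finset.induction_on with
  | empty => simp
  | insert a s ha ih =>
    rw [sum_insert ha, prod_insert ha]
    have ih := ih (fun i hi => h0 i (mem_insert_of_mem hi)) (fun i hi => h1 i (mem_insert_of_mem hi))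
    have ha0 := h0 a (mem_insert_self a s)
    have ha1 := h1 a (mem_insert_self a s)
    have hp : ∏ i ∈ s, x i ≤ 1 :=
      prod_le_one (fun i hi => h0 i (mem_insert_of_mem hi)) (fun i hi => h1 i (mem_insert_of_mem hi))
    nlinarith [mul_nonneg (sub_nonneg.2 ha1) (sub_nonneg.2 hp)]

theorem sum_prod_prod_eq {ι J R : Type*} [Fintype ι] [DecidableEq ι] [Fintype J] [DecidableEq J]
    [CommSemiring R] {κ : ι → Type*} [∀ i, Fintype (κ i)] (f : ∀ i, κ i → R) :
    ∑ ω : ∀ i, J → κ i, ∏ i, ∏ j, f i (ω i j) = ∏ i, (∑ k, f i k) ^ Fintype.card J := by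
  have h : ∀ i, (∑ k, f i k) ^ Fintype.card J = ∑ x : J → κ i, ∏ j, f i (x j) := by
    intro i
    classical
    rw [← card_univ, ← prod_const, Finset.prod_univ_sum, Fintype.piFinset_univ]
  simp_rw [h]
  rw [Finset.prod_univ_sum, Fintype.piFinset_univ]

/-- The two-point bound of Le Cam, in terms of the Bhattacharyya affinity. -/
theorem two_point_bound {Ω : Type*} [Fintype Ω] (p p' f : Ω → ℝ) (s : ℝ) (hp : ∀ ω, 0 ≤ p ω)
    (hp' : ∀ ω, 0 ≤ p' ω) (h : ∑ ω, p ω = 1) (h' : ∑ ω, p' ω = 1) :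
    2 * s ^ 2 * (∑ ω, √(p ω * p' ω)) ^ 2 ≤
      ∑ ω, p ω * (f ω - s) ^ 2 + ∑ ω, p' ω * (f ω + s) ^ 2 := by
  have cs : (∑ ω, √(p ω * p' ω)) ^ 2 ≤
      (∑ ω, p ω * p' ω / (p ω + p' ω)) * ∑ ω, (p ω + p' ω) := by
    refine sum_sq_le_sum_mul_sum_of_sq_le_mul _
      (fun ω _ => div_nonneg (mul_nonneg (hp ω) (hp' ω)) (add_nonneg (hp ω) (hp' ω)))
      (fun ω _ => add_nonneg (hp ω) (hp' ω)) fun ω _ => ?_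
    rw [Real.sq_sqrt (mul_nonneg (hp ω) (hp' ω))]
    refine le_of_eq ?_
    rcases eq_or_ne (p ω + p' ω) 0 with h0 | h0
    · have : p ω = 0 := by linarith [hp ω, hp' ω]
      simp [this]
    · rw [div_mul_cancel₀ _ h0]
  rw [sum_add_distrib, h, h'] at cs
  have key : 4 * s ^ 2 * ∑ ω, p ω * p' ω / (p ω + p' ω) ≤
      ∑ ω, p ω * (f ω - s) ^ 2 + ∑ ω, p' ω * (f ω + s) ^ 2 := by
    rw [mul_sum, ← sum_add_distrib]
    refine sum_le_sum fun ω _ => ?_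
    rcases (add_nonneg (hp ω) (hp' ω)).eq_or_lt with h0 | h0
    · rw [← h0]
      simpa using add_nonneg (mul_nonneg (hp ω) (sq_nonneg _)) (mul_nonneg (hp' ω) (sq_nonneg _))
    · rw [← mul_div_assoc, div_le_iff₀ h0]
      nlinarith [sq_nonneg (p ω * (f ω - s) + p' ω * (f ω + s))]
  nlinarith [sq_nonneg s]

theorem one_sub_le_affinity {κ : Type*} [Fintype κ] (p p' : κ → ℝ) (hp : ∀ k, 0 ≤ p k)
    (hp' : ∀ k, 0 ≤ p' k) (h : ∑ k, p k = 1) (h' : ∑ k, p' k = 1) :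
    1 - (∑ k, (p k - p' k) ^ 2 / (p k + p' k)) / 2 ≤ ∑ k, √(p k * p' k) := by
  have : ∀ k, (p k + p' k) / 2 - (p k - p' k) ^ 2 / (p k + p' k) / 2 ≤ √(p k * p' k) := by
    intro k
    rcases (add_nonneg (hp k) (hp' k)).eq_or_lt with h0 | h0
    · rw [← h0]; simp
    · have h1 : (p k + p' k) / 2 - (p k - p' k) ^ 2 / (p k + p' k) / 2 =
          2 * (p k * p' k) / (p k + p' k) := by
        field_simp; ring
      rw [h1, div_le_iff₀ h0]
      have h2 := Real.sq_sqrt (mul_nonneg (hp k) (hp' k))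
      have h3 := Real.sqrt_nonneg (p k * p' k)
      have h4 : 2 * √(p k * p' k) ≤ p k + p' k := by
        refine abs_le_of_sq_le_sq' ?_ h0.le |>.2
        nlinarith [sq_nonneg (p k - p' k)]
      nlinarith
  have h3 := sum_le_sum fun k (_ : k ∈ univ) => this k
  rw [sum_sub_distrib, ← sum_div, ← sum_div, sum_add_distrib, h, h'] at h3
  linarith

theorem affinity_le_one {κ : Type*} [Fintype κ] (p p' : κ → ℝ) (hp : ∀ k, 0 ≤ p k)
    (hp' : ∀ k, 0 ≤ p' k) (h : ∑ k, p k = 1) (h' : ∑ k, p' k = 1) :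
    ∑ k, √(p k * p' k) ≤ 1 := by
  have : ∀ k, √(p k * p' k) ≤ (p k + p' k) / 2 := fun k => by
    refine Real.sqrt_le_iff.2 ⟨by linarith [hp k, hp' k], by nlinarith [sq_nonneg (p k - p' k)]⟩
  refine (sum_le_sum fun k _ => this k).trans_eq ?_
  rw [← sum_div, sum_add_distrib, h, h']; norm_num

/-- Affinity of two product distributions, bounded below by the triangular discrimination of the
factors. -/
theorem one_sub_le_affinity_prod {ι J : Type*} [Fintype ι] [DecidableEq ι] [Fintype J]
    [DecidableEq J] {κ : ι → Type*} [∀ i, Fintype (κ i)] (p p' : ∀ i, κ i → ℝ)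
    (hp : ∀ i k, 0 ≤ p i k) (hp' : ∀ i k, 0 ≤ p' i k) (h : ∀ i, ∑ k, p i k = 1)
    (h' : ∀ i, ∑ k, p' i k = 1) :
    1 - Fintype.card J * ∑ i, (∑ k, (p i k - p' i k) ^ 2 / (p i k + p' i k)) / 2 ≤
      ∑ ω : ∀ i, J → κ i, √((∏ i, ∏ j, p i (ω i j)) * ∏ i, ∏ j, p' i (ω i j)) := by
  have e : ∀ ω : ∀ i, J → κ i, √((∏ i, ∏ j, p i (ω i j)) * ∏ i, ∏ j, p' i (ω i j)) =
      ∏ i, ∏ j, √(p i (ω i j) * p' i (ω i j)) := by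
    intro ω
    simp_rw [← prod_mul_distrib]
    rw [Real.sqrt_prod _ fun i _ => prod_nonneg fun j _ => mul_nonneg (hp _ _) (hp' _ _)]
    refine prod_congr rfl fun i _ => ?_
    rw [Real.sqrt_prod _ fun j _ => mul_nonneg (hp _ _) (hp' _ _)]
  simp_rw [e]
  rw [sum_prod_prod_eq (fun i k => √(p i k * p' i k))]
  have a0 : ∀ i, 0 ≤ ∑ k, √(p i k * p' i k) := fun i => sum_nonneg fun _ _ => Real.sqrt_nonneg _
  have a1 : ∀ i, ∑ k, √(p i k * p' i k) ≤ 1 := fun i =>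
    affinity_le_one _ _ (hp i) (hp' i) (h i) (h' i)
  have := one_sub_sum_le_prod univ (fun i => (∑ k, √(p i k * p' i k)) ^ Fintype.card J)
    (fun i _ => pow_nonneg (a0 i) _) (fun i _ => pow_le_one₀ (a0 i) (a1 i))
  refine le_trans ?_ this
  rw [mul_sum]
  refine sub_le_sub_left (sum_le_sum fun i _ => ?_) _
  have b := one_add_mul_le_pow (a := ∑ k, √(p i k * p' i k) - 1) (by linarith [a0 i])
    (Fintype.card J)
  have c := one_sub_le_affinity _ _ (hp i) (hp' i) (h i) (h' i)
  rw [add_sub_cancel] at b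
  have d : (0 : ℝ) ≤ Fintype.card J := Nat.cast_nonneg _
  nlinarith

/-- The sign attached to a vertex coordinate of the Boolean cube. -/
def boolSign (b : Bool) : ℝ := if b then 1 else -1

theorem boolSign_not (b : Bool) : boolSign (!b) = -boolSign b := by cases b <;> simp [boolSign]

theorem boolSign_sq (b : Bool) : boolSign b ^ 2 = 1 := by cases b <;> simp [boolSign]

/-- Flip one coordinate of a vertex of the Boolean cube. -/
def flipAt {E : Type*} [DecidableEq E] (e : E) (τ : E → Bool) : E → Bool :=
  Function.update τ e (!τ e)

theorem flipAt_involutive {E : Type*} [DecidableEq E] (e : E) :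
    Function.Involutive (flipAt e : (E → Bool) → E → Bool) := by
  intro τ
  simp [flipAt]

/-- The Assouad lemma for the squared loss on a rectangular cube. -/
theorem assouad {E Ω : Type*} [Fintype E] [DecidableEq E] [Fintype Ω] (p : (E → Bool) → Ω → ℝ)
    (hp : ∀ τ ω, 0 ≤ p τ ω) (h : ∀ τ, ∑ ω, p τ ω = 1) (f : E → Ω → ℝ) (s : E → ℝ)
    (haff : ∀ e τ, 1 / 2 ≤ ∑ ω, √(p τ ω * p (flipAt e τ) ω)) :
    (Fintype.card (E → Bool) : ℝ) * ((∑ e, s e ^ 2) / 4) ≤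
      ∑ τ, ∑ ω, p τ ω * ∑ e, (f e ω - boolSign (τ e) * s e) ^ 2 := by
  have step : ∀ e, (Fintype.card (E → Bool) : ℝ) * (s e ^ 2 / 4) ≤
      ∑ τ, ∑ ω, p τ ω * (f e ω - boolSign (τ e) * s e) ^ 2 := by
    intro e
    set F : (E → Bool) → ℝ := fun τ => ∑ ω, p τ ω * (f e ω - boolSign (τ e) * s e) ^ 2 with hF
    have hsum : ∑ τ, F (flipAt e τ) = ∑ τ, F τ :=
      Equiv.sum_comp (flipAt_involutive e).toPerm F
    have hpair : ∀ τ, s e ^ 2 / 2 ≤ F τ + F (flipAt e τ) := by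
      intro τ
      have := two_point_bound (p τ) (p (flipAt e τ)) (f e) (boolSign (τ e) * s e) (hp _) (hp _)
        (h _) (h _)
      have e1 : boolSign (flipAt e τ e) = -boolSign (τ e) := by simp [flipAt, boolSign_not]
      simp only [hF, e1, neg_mul, sub_neg_eq_add]
      refine le_trans ?_ this
      rw [mul_pow, boolSign_sq, one_mul]
      have h2 := haff e τ
      have : (1 / 4 : ℝ) ≤ (∑ ω, √(p τ ω * p (flipAt e τ) ω)) ^ 2 := by nlinarith
      nlinarith [sq_nonneg (s e)]
    have := sum_le_sum fun τ (_ : τ ∈ univ) => hpair τ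
    rw [sum_add_distrib, hsum, sum_const, card_univ, nsmul_eq_mul] at this
    change _ ≤ ∑ τ, F τ
    linarith
  calc _ = ∑ e, (Fintype.card (E → Bool) : ℝ) * (s e ^ 2 / 4) := by rw [← mul_sum, sum_div]
    _ ≤ ∑ e, ∑ τ, ∑ ω, p τ ω * (f e ω - boolSign (τ e) * s e) ^ 2 := sum_le_sum fun e _ => step e
    _ = _ := by
      rw [sum_comm]
      refine sum_congr rfl fun τ _ => ?_
      rw [sum_comm]
      simp_rw [mul_sum]

theorem sum_div_le_trace {V ι : Type*} [AddCommGroup V] [Module ℝ V] [FiniteDimensional ℝ V]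
    [Fintype ι] (B : LinearMap.BilinForm ℝ V) (hs : ∀ x y, B x y = B y x)
    (hB : ∀ x, x ≠ 0 → 0 < B x x) (L : V →ₗ[ℝ] V) (hL : ∀ x, 0 ≤ B x (L x)) (v : ι → V)
    (hv0 : ∀ i, v i ≠ 0) (hv : ∀ i j, i ≠ j → B (v i) (v j) = 0) :
    ∑ i, B (v i) (L (v i)) / B (v i) (v i) ≤ LinearMap.trace ℝ V L := by
  classical
  let core : InnerProductSpace.Core ℝ V :=
    { inner := fun x y => B x y
      conj_inner_symm := fun x y => hs y x
      re_inner_nonneg := fun x => by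
        rcases eq_or_ne x 0 with rfl | hx
        · simp
        · exact (hB x hx).le
      add_left := fun x y z => by simp
      smul_left := fun x y r => by simp
      definite := fun x hx => by
        by_contra h
        exact (hB x h).ne' hx }
  let _ : NormedAddCommGroup V := core.toNormedAddCommGroup
  let _ : InnerProductSpace ℝ V := .ofCore core.toCore
  have inner_eq : ∀ x y : V, inner ℝ x y = B x y := fun _ _ => rfl
  let w : ι → V := fun i => (√(B (v i) (v i)))⁻¹ • v i
  have ww : ∀ i, B (w i) (L (w i)) = B (v i) (L (v i)) / B (v i) (v i) := by
    intro i
    have := Real.mul_self_sqrt (hB _ (hv0 i)).le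
    simp only [w, map_smul, LinearMap.smul_apply, smul_eq_mul]
    rw [← mul_assoc, ← mul_inv, this, div_eq_inv_mul]
  have hw : Orthonormal ℝ w := by
    rw [orthonormal_iff_ite]
    intro i j
    rw [inner_eq]
    split_ifs with hij
    · subst hij
      have := Real.mul_self_sqrt (hB _ (hv0 i)).le
      simp only [w, map_smul, LinearMap.smul_apply, smul_eq_mul]
      rw [← mul_assoc, ← mul_inv, this, inv_mul_cancel₀ (hB _ (hv0 i)).ne']
    · simp [w, hv i j hij]
  have hinj : Function.Injective w := hw.linearIndependent.injective
  obtain ⟨u, b, hu, hb⟩ := hw.toSubtypeRange.exists_orthonormalBasis_extension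
  have ht : LinearMap.trace ℝ V L = ∑ x ∈ u, B x (L x) := by
    rw [LinearMap.trace_eq_sum_inner L b, ← sum_coe_sort u fun x => B x (L x)]
    simp only [hb, inner_eq]
  rw [ht]
  simp_rw [← ww]
  rw [← sum_image (s := univ) (g := w) (f := fun x => B x (L x)) hinj.injOn]
  refine sum_le_sum_of_subset_of_nonneg (fun x hx => ?_) fun x _ _ => hL x
  obtain ⟨i, -, rfl⟩ := mem_image.1 hx
  exact hu ⟨i, rfl⟩

theorem sum_div_le_trace_of_inverse {V ι : Type*} [AddCommGroup V] [Module ℝ V]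
    [FiniteDimensional ℝ V] [Fintype ι] (B Q : LinearMap.BilinForm ℝ V)
    (hs : ∀ x y, B x y = B y x) (hB : ∀ x, x ≠ 0 → 0 < B x x) (hQs : ∀ x y, Q x y = Q y x)
    (hQ : ∀ x, 0 ≤ Q x x) (L : V →ₗ[ℝ] V) (hL : ∀ x y, Q (L x) y = B x y) (v : ι → V)
    (hv0 : ∀ i, v i ≠ 0) (hv : ∀ i j, i ≠ j → B (v i) (v j) = 0) :
    ∑ i, B (v i) (v i) / Q (v i) (v i) ≤ LinearMap.trace ℝ V L := by
  have hL' : ∀ x, B x (L x) = Q (L x) (L x) := fun x => (hL x (L x)).symm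
  refine le_trans (sum_le_sum fun i _ => ?_)
    (sum_div_le_trace B hs hB L (fun x => (hL' x).symm ▸ hQ _) v hv0 hv)
  have cs := LinearMap.BilinForm.apply_sq_le_of_symm Q hQ ⟨hQs⟩ (L (v i)) (v i)
  rw [hL, ← hL'] at cs
  have hpos := hB _ (hv0 i)
  have hQpos : 0 < Q (v i) (v i) := by
    refine (hQ _).lt_of_ne fun h0 => ?_
    rw [← h0, mul_zero] at cs
    nlinarith
  rw [div_le_div_iff₀ hQpos hpos, ← sq]
  exact cs

/-- Index pairs strictly above the diagonal. -/
abbrev UpperPair (q : ℕ) := {e : Fin q × Fin q // e.1 < e.2}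

theorem two_mul_card_upperPair (q : ℕ) : 2 * (Fintype.card (UpperPair q) : ℝ) + q = (q : ℝ) ^ 2 := by
  have h1 : (Fintype.card (UpperPair q) : ℝ) = ∑ a : Fin q, ∑ b : Fin q, if a < b then 1 else 0 := by
    rw [Fintype.card_subtype, card_filter, ← Fintype.sum_prod_type']
    push_cast
    rfl
  have h2 : (q : ℝ) = ∑ a : Fin q, ∑ b : Fin q, if a = b then 1 else 0 := by simp
  have h3 : (q : ℝ) ^ 2 = ∑ a : Fin q, ∑ b : Fin q, 1 := by simp [sq]
  have h4 := h1
  rw [sum_comm] at h4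
  rw [two_mul]
  nth_rewrite 2 [h4]
  rw [h1, h3]
  rw [h2]
  simp_rw [← sum_add_distrib]
  refine sum_congr rfl fun a _ => sum_congr rfl fun b _ => ?_
  rcases lt_trichotomy a b with h | h | h
  · simp [h, h.not_gt, h.ne]
  · simp [h]
  · simp [h, h.not_gt, h.ne']

theorem sum_upperPair_add_swap_le {q : ℕ} (F : Fin q → Fin q → ℝ) (hF : ∀ a b, 0 ≤ F a b) :
    ∑ e : UpperPair q, (F e.1.1 e.1.2 + F e.1.2 e.1.1) ≤ ∑ a, ∑ b, F a b := by
  have h : ∀ G : Fin q → Fin q → ℝ,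
      ∑ e : UpperPair q, G e.1.1 e.1.2 = ∑ a, ∑ b, if a < b then G a b else 0 := by
    intro G
    rw [← Fintype.sum_prod_type' (f := fun a b => if a < b then G a b else 0), ← sum_filter,
      ← sum_subtype_eq_sum_filter]
    simp only [UpperPair, subtype_univ]
  rw [sum_add_distrib, h F, h fun a b => F b a, sum_comm (f := fun a b => if a < b then F b a else 0),
    ← sum_add_distrib]
  refine sum_le_sum fun a _ => ?_
  rw [← sum_add_distrib]
  refine sum_le_sum fun b _ => ?_
  rcases lt_trichotomy a b with h | h | h
  · simp [h, h.not_gt]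
  · simp [h, hF]
  · simp [h, h.not_gt]

theorem normSq_apply_swap {q : ℕ} {M : Matrix (Fin q) (Fin q) ℂ} (hM : M.IsHermitian)
    (a b : Fin q) : Complex.normSq (M b a) = Complex.normSq (M a b) := by
  rw [← hM.apply b a, Complex.star_def, Complex.normSq_conj]

theorem re_sq_le_normSq (z : ℂ) : z.re ^ 2 ≤ Complex.normSq z := by
  rw [Complex.normSq_apply]; nlinarith [mul_self_nonneg z.im]

theorem sum_re_sq_le_frobSq {q : ℕ} (M : Matrix (Fin q) (Fin q) ℂ) :
    ∑ e : UpperPair q, (M e.1.1 e.1.2).re ^ 2 ≤ frobSq M := by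
  refine le_trans (sum_le_sum fun e _ => ?_)
    (sum_upperPair_add_swap_le (fun a b => Complex.normSq (M a b)) fun _ _ => Complex.normSq_nonneg _)
  linarith [re_sq_le_normSq (M e.1.1 e.1.2), Complex.normSq_nonneg (M e.1.2 e.1.1)]

theorem two_mul_sum_re_sq_le_frobSq {q : ℕ} {M : Matrix (Fin q) (Fin q) ℂ} (hM : M.IsHermitian) :
    2 * ∑ e : UpperPair q, (M e.1.1 e.1.2).re ^ 2 ≤ frobSq M := by
  rw [mul_sum]
  refine le_trans (sum_le_sum fun e _ => ?_)
    (sum_upperPair_add_swap_le (fun a b => Complex.normSq (M a b)) fun _ _ => Complex.normSq_nonneg _)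
  rw [normSq_apply_swap hM e.1.1 e.1.2]
  linarith [re_sq_le_normSq (M e.1.1 e.1.2)]

theorem trace_mul_self_of_isHermitian {q : ℕ} {M : Matrix (Fin q) (Fin q) ℂ}
    (hM : M.IsHermitian) : (M * M).trace = frobSq M := by
  simp only [trace, diag_apply, mul_apply, frobSq, Complex.ofReal_sum]
  refine sum_congr rfl fun a _ => sum_congr rfl fun b _ => ?_
  rw [← hM.apply b a, Complex.star_def, Complex.mul_conj]

theorem im_trace_mul_of_isHermitian {q : ℕ} {A B : Matrix (Fin q) (Fin q) ℂ}
    (hA : A.IsHermitian) (hB : B.IsHermitian) : (A * B).trace.im = 0 := by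
  rw [← Complex.conj_eq_iff_im, ← Complex.star_def, ← trace_conjTranspose, conjTranspose_mul,
    hA.eq, hB.eq, trace_mul_comm]

theorem im_trace_of_isHermitian {q : ℕ} {A : Matrix (Fin q) (Fin q) ℂ} (hA : A.IsHermitian) :
    A.trace.im = 0 := by
  simpa using im_trace_mul_of_isHermitian hA isHermitian_one

theorem frobSq_pos {q : ℕ} {M : Matrix (Fin q) (Fin q) ℂ} (hM : M ≠ 0) : 0 < frobSq M := by
  have h0 : ∀ a, 0 ≤ ∑ b, Complex.normSq (M a b) := fun a =>
    sum_nonneg fun _ _ => Complex.normSq_nonneg _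
  refine (sum_nonneg fun a _ => h0 a).lt_of_ne fun h => hM ?_
  ext a b
  have h1 := (sum_eq_zero_iff_of_nonneg fun a _ => h0 a).1 h.symm a (mem_univ a)
  have h2 := (sum_eq_zero_iff_of_nonneg fun b _ => Complex.normSq_nonneg _).1 h1 b (mem_univ b)
  simpa using h2

theorem one_le_re_trace_of_projection {q : ℕ} {M : Matrix (Fin q) (Fin q) ℂ} (hM : M * M = M)
    (h0 : M ≠ 0) : 1 ≤ M.trace.re := by
  have hid : IsIdempotentElem (toLin' M) := by
    rw [IsIdempotentElem, Module.End.mul_eq_comp, ← toLin'_mul, hM]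
  have ht := (LinearMap.isProj_range_iff_isIdempotentElem _ |>.2 hid).trace
  rw [trace_toLin'_eq] at ht
  rw [ht, Complex.natCast_re]
  norm_cast
  rw [Nat.one_le_iff_ne_zero]
  intro h
  rw [Submodule.finrank_eq_zero, LinearMap.range_eq_bot] at h
  exact h0 (by simpa using h)

/-- The Hermitian matrix with ones at the positions `(a, b)` and `(b, a)`. -/
def realOffDiag {q : ℕ} (e : UpperPair q) : Matrix (Fin q) (Fin q) ℂ :=
  single e.1.1 e.1.2 1 + single e.1.2 e.1.1 1

theorem realOffDiag_isHermitian {q : ℕ} (e : UpperPair q) : (realOffDiag e).IsHermitian := by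
  rw [IsHermitian, realOffDiag, conjTranspose_add, conjTranspose_single, conjTranspose_single,
    star_one, add_comm]

theorem trace_realOffDiag {q : ℕ} (e : UpperPair q) : (realOffDiag e).trace = 0 := by
  rw [realOffDiag, trace_add, trace_single_eq_of_ne _ _ _ e.2.ne, trace_single_eq_of_ne _ _ _ e.2.ne',
    add_zero]

theorem re_trace_realOffDiag_mul {q : ℕ} (e : UpperPair q) {M : Matrix (Fin q) (Fin q) ℂ}
    (hM : M.IsHermitian) : (realOffDiag e * M).trace.re = 2 * (M e.1.1 e.1.2).re := by
  rw [realOffDiag, add_mul, trace_add, trace_single_mul, trace_single_mul, ← hM.apply e.1.2 e.1.1]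
  simp
  ring

theorem realOffDiag_apply {q : ℕ} (e e' : UpperPair q) :
    realOffDiag e e'.1.1 e'.1.2 = if e = e' then 1 else 0 := by
  rw [realOffDiag, Matrix.add_apply, single_apply, single_apply]
  have h2 : ¬ (e.1.2 = e'.1.1 ∧ e.1.1 = e'.1.2) := fun ⟨h, h'⟩ => by
    have := e.2; have := e'.2; rw [h, h'] at *; exact lt_asymm ‹_› ‹_›
  rw [if_neg h2, add_zero]
  simp only [Subtype.ext_iff, Prod.ext_iff]

theorem realOffDiag_ne_zero {q : ℕ} (e : UpperPair q) : realOffDiag e ≠ 0 := fun h => by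
  have := realOffDiag_apply e e
  rw [h] at this
  simp at this

/-- The maximally mixed state perturbed by `c e` at each off-diagonal pair `e`. -/
def perturbedState {q : ℕ} (c : UpperPair q → ℝ) : Matrix (Fin q) (Fin q) ℂ :=
  (q : ℂ)⁻¹ • 1 + ∑ e, (c e : ℂ) • realOffDiag e

theorem perturbedState_isHermitian {q : ℕ} (c : UpperPair q → ℝ) :
    (perturbedState c).IsHermitian := by
  refine IsHermitian.add ?_ (isSelfAdjoint_sum _ fun e _ => ?_)
  · rw [IsHermitian, conjTranspose_smul]; simp
  · rw [← isHermitian_iff_isSelfAdjoint, IsHermitian, conjTranspose_smul, realOffDiag_isHermitian]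
    simp

theorem trace_perturbedState {q : ℕ} (hq : q ≠ 0) (c : UpperPair q → ℝ) :
    (perturbedState c).trace = 1 := by
  simp [perturbedState, trace_sum, trace_smul, trace_realOffDiag, hq]

theorem perturbedState_apply {q : ℕ} (c : UpperPair q → ℝ) (e : UpperPair q) :
    perturbedState c e.1.1 e.1.2 = c e := by
  simp [perturbedState, Matrix.sum_apply, realOffDiag_apply, e.2.ne]

theorem re_trace_perturbedState_mul {q : ℕ} (c : UpperPair q → ℝ) {M : Matrix (Fin q) (Fin q) ℂ}
    (hM : M.IsHermitian) :
    (perturbedState c * M).trace.re =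
      M.trace.re / q + ∑ e : UpperPair q, c e * (2 * (M e.1.1 e.1.2).re) := by
  rw [perturbedState, add_mul, smul_mul_assoc, one_mul, sum_mul, trace_add, trace_smul, trace_sum,
    Complex.add_re, Complex.re_sum]
  congr 1
  · rw [smul_eq_mul, ← Complex.ofReal_natCast, ← Complex.ofReal_inv, Complex.re_ofReal_mul,
      div_eq_inv_mul]
  · refine sum_congr rfl fun e _ => ?_
    rw [smul_mul_assoc, trace_smul, smul_eq_mul, Complex.re_ofReal_mul, re_trace_realOffDiag_mul e hM]

theorem half_le_re_trace_perturbedState_mul {q : ℕ} (hq : 0 < q) (c : UpperPair q → ℝ)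
    (hc : ∑ e, c e ^ 2 ≤ 1 / (8 * (q : ℝ) ^ 2)) {M : Matrix (Fin q) (Fin q) ℂ}
    (hM : M.IsHermitian) (h0 : 0 ≤ M.trace.re) (hF : frobSq M ≤ M.trace.re ^ 2) :
    M.trace.re / (2 * q) ≤ (perturbedState c * M).trace.re := by
  rw [re_trace_perturbedState_mul c hM]
  have hq' : (0 : ℝ) < q := Nat.cast_pos.2 hq
  have cs := sum_mul_sq_le_sq_mul_sq univ c fun e : UpperPair q => 2 * (M e.1.1 e.1.2).re
  have h2 : ∑ e : UpperPair q, (2 * (M e.1.1 e.1.2).re) ^ 2 ≤ 2 * M.trace.re ^ 2 := by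
    have := two_mul_sum_re_sq_le_frobSq hM
    simp_rw [mul_pow]
    rw [← mul_sum]
    linarith
  have h3 : (∑ e : UpperPair q, c e * (2 * (M e.1.1 e.1.2).re)) ^ 2 ≤ (M.trace.re / (2 * q)) ^ 2 := by
    refine cs.trans ((mul_le_mul hc h2 (sum_nonneg fun _ _ => sq_nonneg _) (by positivity)).trans_eq ?_)
    field_simp
    norm_num
  have h4 := (abs_le_of_sq_le_sq' h3 (by positivity)).1
  have h5 : M.trace.re / q = 2 * (M.trace.re / (2 * q)) := by field_simp
  linarith

theorem perturbedState_posSemidef {q : ℕ} (hq : 0 < q) (c : UpperPair q → ℝ)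
    (hc : ∑ e, c e ^ 2 ≤ 1 / (8 * (q : ℝ) ^ 2)) : (perturbedState c).PosSemidef := by
  refine .of_dotProduct_mulVec_nonneg (perturbedState_isHermitian c) fun x => ?_
  have hx : (vecMulVec x (star x)).IsHermitian := (posSemidef_vecMulVec_self_star x).1
  have htr : (vecMulVec x (star x)).trace.re = ∑ a, Complex.normSq (x a) := by
    simp [trace, vecMulVec_apply, Complex.mul_conj]
  have hnn : 0 ≤ (vecMulVec x (star x)).trace.re :=
    htr ▸ sum_nonneg fun _ _ => Complex.normSq_nonneg _
  have hF : frobSq (vecMulVec x (star x)) ≤ (vecMulVec x (star x)).trace.re ^ 2 := by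
    rw [htr, sq, sum_mul_sum]
    simp [frobSq, vecMulVec_apply]
  have key := half_le_re_trace_perturbedState_mul hq c hc hx hnn hF
  have e : star x ⬝ᵥ (perturbedState c *ᵥ x) = (perturbedState c * vecMulVec x (star x)).trace := by
    rw [mul_vecMulVec, trace_vecMulVec, dotProduct_comm]
  rw [Complex.nonneg_iff]
  refine ⟨?_, ((perturbedState_isHermitian c).im_star_dotProduct_mulVec_self x).symm⟩
  rw [e]
  exact le_trans (by positivity) key

theorem norm_apply_le_one_of_posSemidef {q : ℕ} {ρ : Matrix (Fin q) (Fin q) ℂ}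
    (h : ρ.PosSemidef) (ht : ρ.trace = 1) (a b : Fin q) : ‖ρ a b‖ ≤ 1 := by
  have hd : ∀ a, 0 ≤ (ρ a a).re ∧ (ρ a a).im = 0 := fun a => by
    have := Complex.nonneg_iff.1 (h.diag_nonneg (i := a))
    exact ⟨this.1, this.2.symm⟩
  have hd1 : ∀ a, (ρ a a).re ≤ 1 := fun a => by
    have h1 : (ρ.trace).re = 1 := by rw [ht]; simp
    rw [trace, Complex.re_sum] at h1
    exact (single_le_sum (f := fun a => (ρ a a).re) (fun a _ => (hd a).1) (mem_univ a)).trans_eq h1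
  have h2 := (h.submatrix ![a, b]).det_nonneg
  rw [det_fin_two] at h2
  simp only [submatrix_apply, cons_val_zero, cons_val_one] at h2
  rw [← h.1.apply b a, Complex.star_def, Complex.mul_conj] at h2
  have h3 := (Complex.nonneg_iff.1 h2).1
  rw [Complex.sub_re, Complex.mul_re, (hd a).2, (hd b).2, Complex.ofReal_re,
    Complex.normSq_eq_norm_sq] at h3
  nlinarith [norm_nonneg (ρ a b), (hd a).1, (hd b).1, hd1 a, hd1 b]

theorem bddAbove_range_density {q : ℕ} (F : Matrix (Fin q) (Fin q) ℂ → ℝ) (hF : Continuous F) :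
    BddAbove (Set.range fun ρ : {ρ : Matrix (Fin q) (Fin q) ℂ // ρ.PosSemidef ∧ ρ.trace = 1} =>
      F ρ) := by
  have hc : IsCompact (Set.univ.pi fun _ : Fin q => Set.univ.pi fun _ : Fin q =>
      Metric.closedBall (0 : ℂ) 1) :=
    isCompact_univ_pi fun _ => isCompact_univ_pi fun _ => isCompact_closedBall _ _
  refine (hc.bddAbove_image (f := F) hF.continuousOn).mono ?_
  rintro _ ⟨ρ, rfl⟩
  refine ⟨ρ.1, fun a _ b _ => ?_, rfl⟩
  simpa using norm_apply_le_one_of_posSemidef ρ.2.1 ρ.2.2 a b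

/-- The Hilbert–Schmidt inner product on Hermitian matrices. -/
def hilbertSchmidtForm (q : ℕ) :
    LinearMap.BilinForm ℝ ↥(selfAdjoint (Matrix (Fin q) (Fin q) ℂ)) :=
  LinearMap.mk₂ ℝ (fun A B => ((A : Matrix (Fin q) (Fin q) ℂ) * B).trace.re)
    (fun A B C => by simp [add_mul]) (fun c A B => by simp)
    (fun A B C => by simp [mul_add]) (fun c A B => by simp)

/-- The information form `∑_i ∑_k tr(A Π_{ik}) tr(B Π_{ik}) / tr(Π_{ik})` of a design. -/
def informationForm {q n : ℕ} (out : Fin n → ℕ)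
    (P : (i : Fin n) → Fin (out i) → Matrix (Fin q) (Fin q) ℂ) :
    LinearMap.BilinForm ℝ ↥(selfAdjoint (Matrix (Fin q) (Fin q) ℂ)) :=
  LinearMap.mk₂ ℝ (fun A B => ∑ i, ∑ k, ((A : Matrix (Fin q) (Fin q) ℂ) * P i k).trace.re *
      ((B : Matrix (Fin q) (Fin q) ℂ) * P i k).trace.re / (P i k).trace.re)
    (fun A B C => by simp [add_mul, add_div, sum_add_distrib])
    (fun c A B => by simp [mul_sum, mul_assoc, mul_div_assoc])
    (fun A B C => by simp [add_mul, mul_add, add_div, sum_add_distrib])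
    (fun c A B => by simp [mul_sum, mul_div_assoc, mul_left_comm])

theorem informationForm_apply {q n : ℕ} (out : Fin n → ℕ)
    (P : (i : Fin n) → Fin (out i) → Matrix (Fin q) (Fin q) ℂ)
    (A B : ↥(selfAdjoint (Matrix (Fin q) (Fin q) ℂ))) :
    informationForm out P A B = ∑ i, ∑ k, ((A : Matrix (Fin q) (Fin q) ℂ) * P i k).trace.re *
      ((B : Matrix (Fin q) (Fin q) ℂ) * P i k).trace.re / (P i k).trace.re :=
  rfl

/-- The information of a design in the direction `realOffDiag e`. -/
def directionalInformation {q n : ℕ} (out : Fin n → ℕ)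
    (P : (i : Fin n) → Fin (out i) → Matrix (Fin q) (Fin q) ℂ) (e : UpperPair q) : ℝ :=
  ∑ i, ∑ k, (2 * (P i k e.1.1 e.1.2).re) ^ 2 / (P i k).trace.re

theorem re_trace_smul_gramOf_mul {q n : ℕ} (hn : n ≠ 0) (out : Fin n → ℕ)
    (P : (i : Fin n) → Fin (out i) → Matrix (Fin q) (Fin q) ℂ) (hP : ∀ i k, (P i k).IsHermitian)
    (A B : ↥(selfAdjoint (Matrix (Fin q) (Fin q) ℂ))) :
    (((n : ℂ) • gramOf out P A) * (B : Matrix (Fin q) (Fin q) ℂ)).trace.re =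
      informationForm out P A B := by
  have hA : (A : Matrix (Fin q) (Fin q) ℂ).IsHermitian := A.2
  rw [gramOf, smul_smul, mul_inv_cancel₀ (Nat.cast_ne_zero.2 hn), one_smul, sum_mul, trace_sum,
    Complex.re_sum]
  rw [informationForm_apply]
  refine sum_congr rfl fun i _ => ?_
  rw [sum_mul, trace_sum, Complex.re_sum]
  refine sum_congr rfl fun k _ => ?_
  have h1 : ((A : Matrix (Fin q) (Fin q) ℂ) * P i k).trace =
      (((A : Matrix (Fin q) (Fin q) ℂ) * P i k).trace.re : ℂ) :=
    Complex.ext rfl (im_trace_mul_of_isHermitian hA (hP i k))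
  have h2 : (P i k).trace = ((P i k).trace.re : ℂ) :=
    Complex.ext rfl (im_trace_of_isHermitian (hP i k))
  rw [h1, h2, ← Complex.ofReal_div, smul_mul_assoc, trace_smul, smul_eq_mul,
    Complex.re_ofReal_mul, trace_mul_comm (P i k), Complex.ofReal_re, Complex.ofReal_re]
  ring

theorem sum_two_div_directionalInformation_le_trace {q n : ℕ} (hn : n ≠ 0) (out : Fin n → ℕ)
    (P : (i : Fin n) → Fin (out i) → Matrix (Fin q) (Fin q) ℂ) (hP : ∀ i k, (P i k).IsHermitian)
    (htr : ∀ i k, 0 ≤ (P i k).trace.re)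
    (L : ↥(selfAdjoint (Matrix (Fin q) (Fin q) ℂ)) →ₗ[ℝ]
      ↥(selfAdjoint (Matrix (Fin q) (Fin q) ℂ)))
    (hL : ∀ S : ↥(selfAdjoint (Matrix (Fin q) (Fin q) ℂ)),
      (n : ℂ) • gramOf out P (↑(L S)) = (↑S : Matrix (Fin q) (Fin q) ℂ)) :
    ∑ e, 2 / directionalInformation out P e ≤ LinearMap.trace ℝ _ L := by
  have : FiniteDimensional ℝ ↥(selfAdjoint (Matrix (Fin q) (Fin q) ℂ)) :=
    Module.Finite.of_injective (selfAdjoint.submodule ℝ (Matrix (Fin q) (Fin q) ℂ)).subtype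
      Subtype.val_injective
  let v : UpperPair q → ↥(selfAdjoint (Matrix (Fin q) (Fin q) ℂ)) :=
    fun e => ⟨realOffDiag e, realOffDiag_isHermitian e⟩
  have hv : ∀ e e', hilbertSchmidtForm q (v e) (v e') = if e' = e then 2 else 0 := by
    intro e e'
    change (realOffDiag e * realOffDiag e').trace.re = _
    rw [re_trace_realOffDiag_mul e (realOffDiag_isHermitian e'), realOffDiag_apply]
    split_ifs <;> simp
  have hQ : ∀ e, informationForm out P (v e) (v e) = directionalInformation out P e := by
    intro e
    change ∑ i, ∑ k, (realOffDiag e * P i k).trace.re * (realOffDiag e * P i k).trace.re / _ = _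
    simp_rw [re_trace_realOffDiag_mul e (hP _ _), ← sq]
    rfl
  have := sum_div_le_trace_of_inverse (hilbertSchmidtForm q) (informationForm out P)
    (fun A B => congrArg Complex.re (trace_mul_comm _ _))
    (fun A hA => by
      change 0 < ((A : Matrix (Fin q) (Fin q) ℂ) * A).trace.re
      rw [trace_mul_self_of_isHermitian A.2, Complex.ofReal_re]
      exact frobSq_pos fun h => hA (Subtype.ext h))
    (fun A B => by simp_rw [informationForm_apply, mul_comm])
    (fun A => by
      rw [informationForm_apply]
      exact sum_nonneg fun i _ => sum_nonneg fun k _ => div_nonneg (mul_self_nonneg _) (htr i k))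
    L (fun A B => by
      rw [← re_trace_smul_gramOf_mul hn out P hP, hL]
      rfl)
    v (fun e h => realOffDiag_ne_zero e (congrArg Subtype.val h))
    (fun e e' h => by rw [hv, if_neg h.symm])
  simpa only [hv, hQ, if_true] using this

/-- The lower bound, when the shots suffice for the information in the off-diagonal directions. -/
theorem minimax_lower_bound_of_directionalInformation {q n r : ℕ} (hq : 2 ≤ q) (hn : 1 ≤ n) (hr : 1 ≤ r)
    (out : Fin n → ℕ) (P : (i : Fin n) → Fin (out i) → Matrix (Fin q) (Fin q) ℂ)
    (hH : ∀ i k, (P i k).IsHermitian) (hI : ∀ i k, P i k * P i k = P i k)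
    (h1 : ∀ i, ∑ k, P i k = 1) (h0 : ∀ i k, P i k ≠ 0)
    (hcomp : ∀ e, 0 < directionalInformation out P e)
    (hsum : ∑ e, 2 / directionalInformation out P e ≤ r / q)
    (est : ((i : Fin n) → Fin r → Fin (out i)) → Matrix (Fin q) (Fin q) ℂ) :
    (1 / 512 : ℝ) * (q : ℝ) ^ 2 / ((n : ℝ) * r) ≤
      ⨆ ρ : {ρ : Matrix (Fin q) (Fin q) ℂ // ρ.PosSemidef ∧ ρ.trace = 1},
        ∑ ω : (i : Fin n) → Fin r → Fin (out i),
          (∏ i, ∏ j, (((ρ : Matrix (Fin q) (Fin q) ℂ) * P i (ω i j)).trace).re) *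
            frobSq (est ω - (ρ : Matrix (Fin q) (Fin q) ℂ)) := by
  set g := directionalInformation out P with hg
  have hq0 : 0 < q := by omega
  have hqR : (0 : ℝ) < q := Nat.cast_pos.2 hq0
  have hnR : (0 : ℝ) < n := Nat.cast_pos.2 hn
  have hrR : (0 : ℝ) < r := Nat.cast_pos.2 hr
  have hm : ∀ i k, 1 ≤ (P i k).trace.re := fun i k =>
    one_le_re_trace_of_projection (hI i k) (h0 i k)
  have hfrob : ∀ i k, frobSq (P i k) = (P i k).trace.re := fun i k => by
    have := trace_mul_self_of_isHermitian (hH i k)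
    rw [hI] at this
    rw [this, Complex.ofReal_re]
  let s : UpperPair q → ℝ := fun e => √(1 / (4 * q * r * g e))
  have hs : ∀ e, s e ^ 2 = 1 / (4 * q * r * g e) := fun e =>
    Real.sq_sqrt (by have := hcomp e; positivity)
  have hs' : ∑ e, s e ^ 2 = (∑ e, 1 / g e) / (4 * q * r) := by
    rw [sum_div]
    refine sum_congr rfl fun e _ => ?_
    rw [hs, div_div, mul_comm]
  have hsum' : ∑ e, 1 / g e ≤ r / q / 2 := by
    have : ∑ e, 2 / g e = 2 * ∑ e, 1 / g e := by
      rw [mul_sum]; exact sum_congr rfl fun e _ => by ring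
    linarith
  let c : (UpperPair q → Bool) → UpperPair q → ℝ := fun τ e => boolSign (τ e) * s e
  have hc : ∀ τ, ∑ e, c τ e ^ 2 ≤ 1 / (8 * (q : ℝ) ^ 2) := by
    intro τ
    simp only [c, mul_pow, boolSign_sq, one_mul]
    rw [hs', div_le_iff₀ (by positivity)]
    refine hsum'.trans_eq ?_
    field_simp
    norm_num
  let p : (UpperPair q → Bool) → ∀ i, Fin (out i) → ℝ := fun τ i k =>
    (perturbedState (c τ) * P i k).trace.re
  have hp : ∀ τ i k, (P i k).trace.re / (2 * q) ≤ p τ i k := fun τ i k =>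
    half_le_re_trace_perturbedState_mul hq0 _ (hc τ) (hH i k) (by linarith [hm i k])
      (by rw [hfrob]; nlinarith [hm i k])
  have hp0 : ∀ τ i k, 0 ≤ p τ i k := fun τ i k =>
    le_trans (div_nonneg (by linarith [hm i k]) (by positivity)) (hp τ i k)
  have hp1 : ∀ τ i, ∑ k, p τ i k = 1 := by
    intro τ i
    simp only [p]
    rw [← Complex.re_sum, ← trace_sum, ← mul_sum, h1, mul_one, trace_perturbedState hq0.ne']
    rfl
  have hdiff : ∀ e τ i k, (p τ i k - p (flipAt e τ) i k) ^ 2 =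
      4 * s e ^ 2 * (2 * (P i k e.1.1 e.1.2).re) ^ 2 := by
    intro e τ i k
    simp only [p]
    rw [re_trace_perturbedState_mul _ (hH i k), re_trace_perturbedState_mul _ (hH i k),
      add_sub_add_left_eq_sub, ← sum_sub_distrib, sum_eq_single e]
    · simp only [c, flipAt, Function.update_self, boolSign_not]
      linear_combination 4 * s e ^ 2 * (2 * (P i k e.1.1 e.1.2).re) ^ 2 * boolSign_sq (τ e)
    · intro e' _ he
      simp [c, flipAt, Function.update_of_ne he]
    · simp
  have haff : ∀ e τ, 1 / 2 ≤ ∑ ω : (i : Fin n) → Fin r → Fin (out i),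
      √((∏ i, ∏ j, p τ i (ω i j)) * ∏ i, ∏ j, p (flipAt e τ) i (ω i j)) := by
    intro e τ
    refine le_trans ?_ (one_sub_le_affinity_prod (p τ) (p (flipAt e τ)) (hp0 _) (hp0 _) (hp1 _)
      (hp1 _))
    have hb : ∑ i, (∑ k, (p τ i k - p (flipAt e τ) i k) ^ 2 / (p τ i k + p (flipAt e τ) i k)) / 2
        ≤ 2 * s e ^ 2 * q * g e := by
      rw [hg, directionalInformation, mul_sum]
      refine sum_le_sum fun i _ => ?_
      rw [mul_sum, sum_div]
      refine sum_le_sum fun k _ => ?_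
      have hmk := hm i k
      have hpp : (P i k).trace.re / q ≤ p τ i k + p (flipAt e τ) i k := by
        have e1 : (P i k).trace.re / q = 2 * ((P i k).trace.re / (2 * q)) := by field_simp
        linarith [hp τ i k, hp (flipAt e τ) i k]
      rw [hdiff]
      have : 0 < (P i k).trace.re / q := by positivity
      calc _ ≤ 4 * s e ^ 2 * (2 * (P i k e.1.1 e.1.2).re) ^ 2 / ((P i k).trace.re / q) / 2 := by
            gcongr
        _ = _ := by field_simp; ring
    rw [hs] at hb
    have e2 : 2 * (1 / (4 * q * r * g e)) * q * g e = 1 / (2 * r) := by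
      have := (hcomp e).ne'
      field_simp
      norm_num
    rw [e2] at hb
    have e3 : (r : ℝ) * (1 / (2 * r)) = 1 / 2 := by field_simp
    rw [Fintype.card_fin]
    have := mul_le_mul_of_nonneg_left hb hrR.le
    linarith
  have hass := assouad (fun τ (ω : (i : Fin n) → Fin r → Fin (out i)) => ∏ i, ∏ j, p τ i (ω i j))
    (fun τ ω => prod_nonneg fun i _ => prod_nonneg fun j _ => hp0 _ _ _)
    (fun τ => by rw [sum_prod_prod_eq (p τ)]; simp [hp1])
    (fun e ω => (est ω e.1.1 e.1.2).re) s haff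
  set R : Matrix (Fin q) (Fin q) ℂ → ℝ := fun ρ =>
    ∑ ω : (i : Fin n) → Fin r → Fin (out i),
      (∏ i, ∏ j, ((ρ * P i (ω i j)).trace).re) * frobSq (est ω - ρ) with hR
  have hRc : Continuous R := by
    simp only [hR, frobSq, trace, diag_apply, mul_apply, Matrix.sub_apply]
    have : ∀ a b, Continuous fun ρ : Matrix (Fin q) (Fin q) ℂ => ρ a b := fun a b =>
      (continuous_apply b).comp (continuous_apply a)
    have := Complex.continuous_normSq
    fun_prop
  have hbdd := bddAbove_range_density R hRc
  change _ ≤ ⨆ ρ : {ρ : Matrix (Fin q) (Fin q) ℂ // ρ.PosSemidef ∧ ρ.trace = 1}, R ρ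
  set M := ⨆ ρ : {ρ : Matrix (Fin q) (Fin q) ℂ // ρ.PosSemidef ∧ ρ.trace = 1}, R ρ with hM
  have hle : ∀ τ, ∑ ω : (i : Fin n) → Fin r → Fin (out i), (∏ i, ∏ j, p τ i (ω i j)) *
      ∑ e : UpperPair q, ((est ω e.1.1 e.1.2).re - boolSign (τ e) * s e) ^ 2 ≤ M := by
    intro τ
    have hval : R (perturbedState (c τ)) ≤ M := le_ciSup hbdd ⟨perturbedState (c τ),
      perturbedState_posSemidef hq0 _ (hc τ), trace_perturbedState hq0.ne' _⟩
    refine le_trans ?_ hval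
    refine sum_le_sum fun ω _ => mul_le_mul_of_nonneg_left ?_
      (prod_nonneg fun i _ => prod_nonneg fun j _ => hp0 _ _ _)
    refine le_trans (le_of_eq ?_) (sum_re_sq_le_frobSq _)
    refine sum_congr rfl fun e _ => ?_
    rw [Matrix.sub_apply, perturbedState_apply, Complex.sub_re, Complex.ofReal_re]
  have hMlow : (∑ e, s e ^ 2) / 4 ≤ M := by
    have h2 := hass.trans (sum_le_sum fun τ (_ : τ ∈ univ) => hle τ)
    rw [sum_const, card_univ, nsmul_eq_mul] at h2
    exact le_of_mul_le_mul_left h2 (Nat.cast_pos.2 Fintype.card_pos)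
  have hgsum : ∑ e, g e ≤ 2 * n * q := by
    have hout : ∀ i, (out i : ℝ) ≤ q := by
      intro i
      have h2 := congrArg (fun A => (trace A).re) (h1 i)
      simp only [trace_sum, Complex.re_sum, trace_one, Fintype.card_fin, Complex.natCast_re] at h2
      rw [← h2]
      simpa using sum_le_sum fun k (_ : k ∈ univ) => hm i k
    calc ∑ e, g e = ∑ i, ∑ k, ∑ e : UpperPair q,
          (2 * (P i k e.1.1 e.1.2).re) ^ 2 / (P i k).trace.re := by
          simp only [hg, directionalInformation]
          rw [sum_comm]
          exact sum_congr rfl fun i _ => sum_comm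
      _ ≤ ∑ i, ∑ k : Fin (out i), (2 : ℝ) := by
          refine sum_le_sum fun i _ => sum_le_sum fun k _ => ?_
          have hmk := hm i k
          rw [← sum_div, div_le_iff₀ (by linarith)]
          have := two_mul_sum_re_sq_le_frobSq (hH i k)
          rw [hfrob] at this
          simp_rw [mul_pow]
          rw [← mul_sum]
          linarith
      _ = ∑ i, 2 * (out i : ℝ) := by simp [mul_comm]
      _ ≤ ∑ i : Fin n, 2 * (q : ℝ) := sum_le_sum fun i _ => by linarith [hout i]
      _ = _ := by simp; ring
  have hcard : (q : ℝ) ^ 2 / 4 ≤ Fintype.card (UpperPair q) := by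
    have h2 := two_mul_card_upperPair q
    have h3 : (2 : ℝ) ≤ q := by exact_mod_cast hq
    nlinarith
  have htitu : (q : ℝ) ^ 3 / (32 * n) ≤ ∑ e, 1 / g e := by
    have h2 := sq_sum_div_le_sum_sq_div univ (fun _ : UpperPair q => (1 : ℝ)) (g := g)
      fun e _ => hcomp e
    simp only [sum_const, card_univ, nsmul_eq_mul, mul_one, one_pow] at h2
    refine le_trans ?_ h2
    have hcpos : (0 : ℝ) < Fintype.card (UpperPair q) := lt_of_lt_of_le (by positivity) hcard
    have hgpos : 0 < ∑ e, g e := sum_pos (fun e _ => hcomp e)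
      (univ_nonempty_iff.2 (Fintype.card_pos_iff.1 (Nat.cast_pos.1 hcpos)))
    calc (q : ℝ) ^ 3 / (32 * n) = ((q : ℝ) ^ 2 / 4) ^ 2 / (2 * n * q) := by
          field_simp; norm_num
      _ ≤ _ := by gcongr
  refine le_trans ?_ hMlow
  rw [hs']
  calc (1 / 512 : ℝ) * (q : ℝ) ^ 2 / ((n : ℝ) * r) ≤ (q : ℝ) ^ 3 / (32 * n) / (4 * q * r) / 4 := by
        apply le_of_eq; field_simp; norm_num
    _ ≤ _ := by gcongr

theorem directionalInformation_pos {q n : ℕ} (out : Fin n → ℕ)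
    (P : (i : Fin n) → Fin (out i) → Matrix (Fin q) (Fin q) ℂ) (hP : ∀ i k, (P i k).IsHermitian)
    (htr : ∀ i k, 0 < (P i k).trace.re)
    (hcomp : ∀ Δ : Matrix (Fin q) (Fin q) ℂ, Δ.IsHermitian → Δ.trace = 0 →
      (∀ i k, (Δ * P i k).trace = 0) → Δ = 0) (e : UpperPair q) :
    0 < directionalInformation out P e := by
  have hnn : ∀ i k, 0 ≤ (2 * (P i k e.1.1 e.1.2).re) ^ 2 / (P i k).trace.re := fun i k =>
    div_nonneg (sq_nonneg _) (htr i k).le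
  refine (sum_nonneg fun i _ => sum_nonneg fun k _ => hnn i k).lt_of_ne fun h =>
    realOffDiag_ne_zero e (hcomp _ (realOffDiag_isHermitian e) (trace_realOffDiag e) fun i k => ?_)
  have h1 := (sum_eq_zero_iff_of_nonneg fun i _ => sum_nonneg fun k _ => hnn i k).1 h.symm i
    (mem_univ i)
  have h2 := (sum_eq_zero_iff_of_nonneg fun k _ => hnn i k).1 h1 k (mem_univ k)
  rw [div_eq_zero_iff, or_iff_left (htr i k).ne', sq_eq_zero_iff,
    ← re_trace_realOffDiag_mul e (hP i k)] at h2
  exact Complex.ext h2 (im_trace_mul_of_isHermitian (realOffDiag_isHermitian e) (hP i k))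

/-- **minimax lower bound.** There are universal constants `c₀, C > 0` such
that for every complete design on `ℂ^q` with `r ≥ c₀ q tr((nG)⁻¹)` shots per observable and
every estimator `ρ̂`, the supremum over density matrices `ρ` of the mean-squared error
`E_ρ ‖ρ̂ − ρ‖₂²` is at least `C q²/(nr)`. -/
theorem minimax_lower_bound :
    ∃ c₀ : ℝ, 0 < c₀ ∧ ∃ C : ℝ, 0 < C ∧
    ∀ (q n r : ℕ), 2 ≤ q → 1 ≤ n → 1 ≤ r →
    ∀ (out : Fin n → ℕ), (∀ i, 2 ≤ out i) →
    ∀ (P : (i : Fin n) → Fin (out i) → Matrix (Fin q) (Fin q) ℂ),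
      (∀ i k, (P i k).IsHermitian) →
      (∀ i k, P i k * P i k = P i k) →
      (∀ i (k k' : Fin (out i)), k ≠ k' → P i k * P i k' = 0) →
      (∀ i, ∑ k, P i k = 1) →
      (∀ i k, P i k ≠ 0) →
      -- completeness
      (∀ Δ : Matrix (Fin q) (Fin q) ℂ, Δ.IsHermitian → Δ.trace = 0 →
        (∀ i k, (Δ * P i k).trace = 0) → Δ = 0) →
      -- Ginv is the inverse of n·G on the Hermitian matrices
      ∀ Ginv : ↥(selfAdjoint (Matrix (Fin q) (Fin q) ℂ)) →ₗ[ℝ]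
               ↥(selfAdjoint (Matrix (Fin q) (Fin q) ℂ)),
        (∀ S : ↥(selfAdjoint (Matrix (Fin q) (Fin q) ℂ)),
          (n : ℂ) • gramOf out P (↑(Ginv S)) = (↑S : Matrix (Fin q) (Fin q) ℂ)) →
        c₀ * q * LinearMap.trace ℝ _ Ginv ≤ (r : ℝ) →
      ∀ est : ((i : Fin n) → Fin r → Fin (out i)) → Matrix (Fin q) (Fin q) ℂ,
        C * (q : ℝ) ^ 2 / ((n : ℝ) * r) ≤
          ⨆ ρ : {ρ : Matrix (Fin q) (Fin q) ℂ // ρ.PosSemidef ∧ ρ.trace = 1},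
            ∑ ω : (i : Fin n) → Fin r → Fin (out i),
              (∏ i, ∏ j, (((ρ : Matrix (Fin q) (Fin q) ℂ) * P i (ω i j)).trace).re) *
                frobSq (est ω - (ρ : Matrix (Fin q) (Fin q) ℂ)) := by
  refine ⟨1, one_pos, 1 / 512, by norm_num, ?_⟩
  intro q n r hq hn hr out _ P hH hI _ h1 h0 hcomp Ginv hG hrT est
  have hm : ∀ i k, 0 < (P i k).trace.re := fun i k =>
    one_pos.trans_le (one_le_re_trace_of_projection (hI i k) (h0 i k))
  refine minimax_lower_bound_of_directionalInformation hq hn hr out P hH hI h1 h0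
    (directionalInformation_pos out P hH hm hcomp) ?_ est
  refine (sum_two_div_directionalInformation_le_trace (by omega) out P hH
    (fun i k => (hm i k).le) Ginv hG).trans ?_
  rw [le_div_iff₀ (Nat.cast_pos.2 (by omega))]
  linarith
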